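/- arXiv:2009.12397 — 2 statements merged into one kernel-verified Lean document; each statement's English description precedes it below -/
import Mathlib

section
/- Let X and Y be Banach spaces and let A and B be closed linear relations from X to Y with D(A) = D(B) = X, R(A) closed, B(0) ⊆ A(0), and B bounded, i.e. there is C ≥ 0 with dist(z, B(0)) ≤ C·‖x‖ for every (x,z) ∈ G(B). Then for every n ≥ 1, N(A) ⊆ M_n if and only if N(A′) ⊆ M′_n; consequently ν(A′ : B′) = ν(A : B), where ν(A : B) denotes the smallest n for which N(A) ⊆ M_n fails (ν(A : B) := ∞ if no such n exists). -/
open Metric Set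

section Defs

variable {X Y : Type*} [AddCommGroup X] [Module ℂ X] [AddCommGroup Y] [Module ℂ Y]

/-- The domain `D(A)` of a linear relation (given by its graph). -/
def relDom (A : Submodule ℂ (X × Y)) : Set X := {x | ∃ y, (x, y) ∈ A}

/-- The range `R(A)` of a linear relation. -/
def relRan (A : Submodule ℂ (X × Y)) : Set Y := {y | ∃ x, (x, y) ∈ A}

/-- The null space `N(A)` of a linear relation. -/
def relKer (A : Submodule ℂ (X × Y)) : Set X := {x | (x, (0 : Y)) ∈ A}

/-- The set `A(0)` of a linear relation. -/
def relMul0 (A : Submodule ℂ (X × Y)) : Set Y := {y | ((0 : X), y) ∈ A}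

/-- The image `A(M)` of a set under a linear relation. -/
def relImg (A : Submodule ℂ (X × Y)) (M : Set X) : Set Y := {y | ∃ x ∈ M, (x, y) ∈ A}

/-- The preimage `A⁻¹(S)` of a set under a linear relation. -/
def relPre (A : Submodule ℂ (X × Y)) (S : Set Y) : Set X := {x | ∃ y ∈ S, (x, y) ∈ A}

/-- The sequence `M_n`: `M_0 = X`, `M_n = B⁻¹(A(M_{n-1}))`. -/
def Mseq (A B : Submodule ℂ (X × Y)) : ℕ → Set X
  | 0 => univ
  | n + 1 => relPre B (relImg A (Mseq A B n))

end Defs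

section Dual

variable {X Y : Type*} [NormedAddCommGroup X] [NormedSpace ℂ X]
  [NormedAddCommGroup Y] [NormedSpace ℂ Y]

/-- The adjoint relation `A′` from `Y′` to `X′`:
`(y′, x′) ∈ G(A′)` iff `y′(y) = x′(x)` for all `(x, y) ∈ G(A)`. -/
noncomputable def relAdj (A : Submodule ℂ (X × Y)) :
    Submodule ℂ ((Y →L[ℂ] ℂ) × (X →L[ℂ] ℂ)) where
  carrier := {p | ∀ x y, (x, y) ∈ A → p.1 y = p.2 x}
  add_mem' := by
    intro p q hp hq x y hxy
    simp only [Prod.fst_add, Prod.snd_add, ContinuousLinearMap.add_apply,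
      hp x y hxy, hq x y hxy]
  zero_mem' := by intro x y _; simp
  smul_mem' := by
    intro c p hp x y hxy
    simp only [Prod.smul_fst, Prod.smul_snd, ContinuousLinearMap.coe_smul',
      Pi.smul_apply, hp x y hxy]

/-- The annihilator `S^⊥` of a set `S ⊆ Y` in the continuous dual. -/
def annih (S : Set Y) : Set (Y →L[ℂ] ℂ) := {f | ∀ s ∈ S, f s = 0}

end Dual

/-- `ν(A : B)`: the smallest `n` for which `N(A) ⊆ M_n` fails (`∞` if none). -/
noncomputable def nuRel {X Y : Type*} [AddCommGroup X] [Module ℂ X]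
    [AddCommGroup Y] [Module ℂ Y] (A B : Submodule ℂ (X × Y)) : ℕ∞ :=
  sInf {c : ℕ∞ | ∃ n : ℕ, c = (n : ℕ∞) ∧ ¬ relKer A ⊆ Mseq A B n}

section Relations

variable {X Y : Type*} [AddCommGroup X] [Module ℂ X] [AddCommGroup Y] [Module ℂ Y]

/-- The iterated kernels of a pair of linear relations, indexed from zero:
`Nseq A B 0 = N(A)` and `Nseq A B (n + 1) = A⁻¹(B(Nseq A B n))`. -/
def Nseq (A B : Submodule ℂ (X × Y)) : ℕ → Set X
  | 0 => relKer A
  | n + 1 => relPre A (relImg B (Nseq A B n))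

theorem Mseq_succ_subset (A B : Submodule ℂ (X × Y)) (n : ℕ) :
    Mseq A B (n + 1) ⊆ Mseq A B n := by
  induction n with
  | zero => exact subset_univ _
  | succ n ih =>
    rintro x ⟨w, ⟨x', hx', hA⟩, hB⟩
    exact ⟨w, ⟨x', ih hx', hA⟩, hB⟩

theorem Mseq_antitone (A B : Submodule ℂ (X × Y)) : Antitone (Mseq A B) :=
  antitone_nat_of_succ_le (Mseq_succ_subset A B)

theorem Nseq_subset_relDom (A B : Submodule ℂ (X × Y)) (n : ℕ) : Nseq A B n ⊆ relDom A := by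
  cases n with
  | zero => exact fun x hx => ⟨0, hx⟩
  | succ n => exact fun x ⟨w, _, hA⟩ => ⟨w, hA⟩

theorem Nseq_subset_Mseq {A B : Submodule ℂ (X × Y)} {n : ℕ}
    (h : ∀ k < n, Nseq A B k ⊆ Mseq A B 1) {k m : ℕ} (hkm : k + m ≤ n) :
    Nseq A B k ⊆ Mseq A B m := by
  induction m generalizing k with
  | zero => exact subset_univ _
  | succ m ih =>
    intro x hx
    obtain ⟨w, ⟨x', -, hA⟩, hB⟩ := h k (by omega) hx
    exact ⟨w, ⟨x', ih (k := k + 1) (by omega) ⟨w, ⟨x, hx, hB⟩, hA⟩, hA⟩, hB⟩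

end Relations

section Duality

variable {X Y : Type*} [NormedAddCommGroup X] [NormedSpace ℂ X]
  [NormedAddCommGroup Y] [NormedSpace ℂ Y]

theorem apply_eq_zero_of_mem_Nseq (A B : Submodule ℂ (X × Y)) {n : ℕ} {x : X}
    (hx : x ∈ Nseq A B n) {w : Y} (hw : (x, w) ∈ B) {f : Y →L[ℂ] ℂ}
    (hf : f ∈ Mseq (relAdj A) (relAdj B) (n + 1)) : f w = 0 := by
  induction n generalizing x w f with
  | zero =>
    obtain ⟨g, ⟨f', -, hA⟩, hB⟩ := hf
    rw [hB x w hw, ← hA x 0 hx, map_zero]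
  | succ n ih =>
    obtain ⟨g, ⟨f', hf', hA⟩, hB⟩ := hf
    obtain ⟨v, ⟨u, hu, huv⟩, hxv⟩ := hx
    rw [hB x w hw, ← hA x v hxv]
    exact ih hu huv hf'

theorem apply_eq_zero_of_mem_Mseq (A B : Submodule ℂ (X × Y)) {n : ℕ} {f : Y →L[ℂ] ℂ}
    (hf : f ∈ Nseq (relAdj A) (relAdj B) n) {g : X →L[ℂ] ℂ} (hg : (f, g) ∈ relAdj B) {x : X}
    (hx : x ∈ Mseq A B (n + 1)) : g x = 0 := by
  induction n generalizing x f g with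
  | zero =>
    obtain ⟨w, ⟨x', -, hA⟩, hB⟩ := hx
    rw [← hg x w hB, hf x' w hA, zero_apply]
  | succ n ih =>
    obtain ⟨w, ⟨x', hx', hA⟩, hB⟩ := hx
    obtain ⟨h, ⟨f', hf', hf'h⟩, hfh⟩ := hf
    rw [← hg x w hB, hfh x' w hA]
    exact ih hf' hf'h hx'

theorem exists_dual_eq_of_bound (R : Submodule ℂ (X × Y)) (φ : Y →L[ℂ] ℂ) (K : ℝ)
    (hK : ∀ x y, (x, y) ∈ R → ‖φ y‖ ≤ K * ‖x‖) :
    ∃ ψ : X →L[ℂ] ℂ, ∀ x y, (x, y) ∈ R → ψ x = φ y := by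
  have huniq {x : X} {y z : Y} (hy : (x, y) ∈ R) (hz : (x, z) ∈ R) : φ y = φ z := by
    have hyz : ((0 : X), y - z) ∈ R := by simpa using R.sub_mem hy hz
    have := hK _ _ hyz
    rw [norm_zero, mul_zero, norm_le_zero_iff, map_sub] at this
    exact sub_eq_zero.1 this
  let D : Submodule ℂ X := R.map (LinearMap.fst ℂ X Y)
  have hD (x : D) : ∃ y, ((x : X), y) ∈ R := by
    obtain ⟨-, ⟨x, y⟩, hxy, rfl⟩ := x
    exact ⟨y, hxy⟩
  choose s hs using hD
  let ψ₀ : D →ₗ[ℂ] ℂ :=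
    { toFun := fun x => φ (s x)
      map_add' := fun x y => by
        rw [← map_add]
        exact huniq (hs _) (R.add_mem (hs x) (hs y))
      map_smul' := fun c x => by
        rw [RingHom.id_apply, ← map_smul]
        exact huniq (hs _) (R.smul_mem c (hs x)) }
  obtain ⟨ψ, hψ, -⟩ := exists_extension_norm_eq D
    (ψ₀.mkContinuous K fun x => hK _ _ (hs x))
  refine ⟨ψ, fun x y hxy => ?_⟩
  have hx : x ∈ D := ⟨(x, y), hxy, rfl⟩
  exact (hψ ⟨x, hx⟩).trans (huniq (hs ⟨x, hx⟩) hxy)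

theorem coe_map_snd_eq_relRan (A : Submodule ℂ (X × Y)) :
    (A.map (LinearMap.snd ℂ X Y) : Set Y) = relRan A := by
  ext y
  simp [relRan]

theorem mem_relRan_of_forall_relKer_relAdj {A : Submodule ℂ (X × Y)} (hRA : IsClosed (relRan A))
    {y : Y} (hy : ∀ f ∈ relKer (relAdj A), f y = 0) : y ∈ relRan A := by
  let p : Submodule ℂ Y := A.map (LinearMap.snd ℂ X Y)
  have hp : IsClosed (p : Set Y) := by rwa [coe_map_snd_eq_relRan]
  rw [← coe_map_snd_eq_relRan]
  change y ∈ p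
  by_contra hyp
  have hne : ‖p.mkQL y‖ ≠ 0 := by simpa using hyp
  obtain ⟨g, -, hg⟩ := exists_dual_vector ℂ (p.mkQL y) hne
  have hker : g.comp p.mkQL ∈ relKer (relAdj A) := by
    intro x z hxz
    have hz : p.mkQL z = 0 := (Submodule.Quotient.mk_eq_zero p).2 ⟨(x, z), hxz, rfl⟩
    simp [hz]
  have := hy _ hker
  rw [ContinuousLinearMap.comp_apply, hg] at this
  exact hne (RCLike.ofReal_eq_zero.1 this)

theorem mem_relRan_relAdj_of_forall_relKer [CompleteSpace X] [CompleteSpace Y]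
    {A : Submodule ℂ (X × Y)} (hA : IsClosed (A : Set (X × Y))) (hRA : IsClosed (relRan A))
    {g : X →L[ℂ] ℂ} (hg : ∀ x ∈ relKer A, g x = 0) : g ∈ relRan (relAdj A) := by
  let p : Submodule ℂ Y := A.map (LinearMap.snd ℂ X Y)
  have hp : IsClosed (p : Set Y) := by rwa [coe_map_snd_eq_relRan]
  have := hA.completeSpace_coe
  have := hp.completeSpace_coe
  let T : A →L[ℂ] p := ((ContinuousLinearMap.snd ℂ X Y).comp A.subtypeL).codRestrict p
    fun a => ⟨a, a.2, rfl⟩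
  have hT : Function.Surjective T := by
    rintro ⟨-, a, ha, rfl⟩
    exact ⟨⟨a, ha⟩, rfl⟩
  obtain ⟨K, -, hK⟩ := T.exists_preimage_norm_le hT
  obtain ⟨f, hf⟩ := exists_dual_eq_of_bound
    (A.comap (LinearEquiv.prodComm ℂ Y X : (Y × X) →ₗ[ℂ] X × Y)) g (‖g‖ * K) fun y x hxy => by
      have hxy : (x, y) ∈ A := hxy
      obtain ⟨⟨⟨x', y'⟩, ha⟩, hay, hle⟩ := hK ⟨y, (x, y), hxy, rfl⟩
      obtain rfl : y' = y := congrArg Subtype.val hay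
      have hker : g (x - x') = 0 := hg _ (by simpa [relKer] using A.sub_mem hxy ha)
      rw [map_sub, sub_eq_zero] at hker
      rw [hker, mul_assoc]
      exact (g.le_opNorm x').trans
        (mul_le_mul_of_nonneg_left ((norm_fst_le (x', y')).trans hle) (norm_nonneg g))
  exact ⟨f, fun x y hxy => hf y x hxy⟩

theorem exists_mem_relAdj_of_infDist_le {B : Submodule ℂ (X × Y)} {C : ℝ}
    (hbdd : ∀ x z, (x, z) ∈ B → infDist z (relMul0 B) ≤ C * ‖x‖) {f : Y →L[ℂ] ℂ}
    (hf : f ∈ annih (relMul0 B)) : ∃ g, (f, g) ∈ relAdj B := by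
  obtain ⟨g, hg⟩ := exists_dual_eq_of_bound B f (‖f‖ * C) fun x z hxz => by
    have hne : (relMul0 B).Nonempty := ⟨0, B.zero_mem⟩
    have hle : ‖f z‖ ≤ ‖f‖ * infDist z (relMul0 B) := by
      refine le_of_forall_pos_le_add fun ε hε => ?_
      have hδ : 0 < ε / (‖f‖ + 1) := by positivity
      obtain ⟨b, hb, hdist⟩ := (infDist_lt_iff hne).1
        (lt_add_of_pos_right (infDist z (relMul0 B)) hδ)
      have hsub : f z = f (z - b) := by rw [map_sub, hf b hb, sub_zero]
      have hmul : ‖f‖ * (ε / (‖f‖ + 1)) ≤ ε := by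
        rw [mul_div_assoc', div_le_iff₀ (by positivity)]
        nlinarith
      calc ‖f z‖ ≤ ‖f‖ * dist z b := by
            rw [hsub, dist_eq_norm]
            exact f.le_opNorm _
        _ ≤ ‖f‖ * (infDist z (relMul0 B) + ε / (‖f‖ + 1)) := by gcongr
        _ ≤ ‖f‖ * infDist z (relMul0 B) + ε := by rw [mul_add]; gcongr
    rw [mul_assoc]
    exact hle.trans (mul_le_mul_of_nonneg_left (hbdd x z hxz) (norm_nonneg f))
  exact ⟨g, fun x y hxy => (hg x y hxy).symm⟩

theorem relDom_relAdj_subset_annih (A : Submodule ℂ (X × Y)) :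
    relDom (relAdj A) ⊆ annih (relMul0 A) := by
  rintro f ⟨g, hg⟩ y hy
  rw [hg 0 y hy, map_zero]

theorem relKer_subset_Mseq_of_relAdj {A B : Submodule ℂ (X × Y)} (hdomB : relDom B = univ)
    (hRA : IsClosed (relRan A)) {n : ℕ}
    (h : relKer (relAdj A) ⊆ Mseq (relAdj A) (relAdj B) n) : relKer A ⊆ Mseq A B n := by
  refine Nseq_subset_Mseq (n := n) (k := 0) (fun k hk x hx => ?_) (zero_add n).le
  obtain ⟨w, hw⟩ : x ∈ relDom B := hdomB ▸ mem_univ x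
  obtain ⟨x', hx'⟩ := mem_relRan_of_forall_relKer_relAdj hRA fun f hf =>
    apply_eq_zero_of_mem_Nseq A B hx hw (Mseq_antitone _ _ hk (h hf))
  exact ⟨w, ⟨x', mem_univ _, hx'⟩, hw⟩

theorem relKer_relAdj_subset_Mseq [CompleteSpace X] [CompleteSpace Y]
    {A B : Submodule ℂ (X × Y)} (hA : IsClosed (A : Set (X × Y))) (hRA : IsClosed (relRan A))
    (h0 : relMul0 B ⊆ relMul0 A) {C : ℝ}
    (hbdd : ∀ x z, (x, z) ∈ B → infDist z (relMul0 B) ≤ C * ‖x‖) {n : ℕ}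
    (h : relKer A ⊆ Mseq A B n) : relKer (relAdj A) ⊆ Mseq (relAdj A) (relAdj B) n := by
  refine Nseq_subset_Mseq (n := n) (k := 0) (fun k hk f hf => ?_) (zero_add n).le
  have hann : f ∈ annih (relMul0 B) := fun y hy =>
    relDom_relAdj_subset_annih A (Nseq_subset_relDom _ _ k hf) y (h0 hy)
  obtain ⟨g, hg⟩ := exists_mem_relAdj_of_infDist_le hbdd hann
  obtain ⟨f', hf'⟩ := mem_relRan_relAdj_of_forall_relKer hA hRA fun x hx =>
    apply_eq_zero_of_mem_Mseq A B hf hg (Mseq_antitone _ _ hk (h hx))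
  exact ⟨g, ⟨f', mem_univ _, hf'⟩, hg⟩

end Duality

theorem stmt9 {X Y : Type*} [NormedAddCommGroup X] [NormedSpace ℂ X] [CompleteSpace X]
    [NormedAddCommGroup Y] [NormedSpace ℂ Y] [CompleteSpace Y]
    (A B : Submodule ℂ (X × Y))
    (hA : IsClosed (A : Set (X × Y))) (hB : IsClosed (B : Set (X × Y)))
    (hdomA : relDom A = univ) (hdomB : relDom B = univ)
    (hRA : IsClosed (relRan A)) (h0 : relMul0 B ⊆ relMul0 A)
    (C : ℝ) (hC : 0 ≤ C)
    (hbdd : ∀ x z, (x, z) ∈ B → infDist z (relMul0 B) ≤ C * ‖x‖) :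
    (∀ n : ℕ, 1 ≤ n →
      (relKer A ⊆ Mseq A B n ↔ relKer (relAdj A) ⊆ Mseq (relAdj A) (relAdj B) n)) ∧
    nuRel (relAdj A) (relAdj B) = nuRel A B := by
  have key (n : ℕ) :
      relKer A ⊆ Mseq A B n ↔ relKer (relAdj A) ⊆ Mseq (relAdj A) (relAdj B) n :=
    ⟨relKer_relAdj_subset_Mseq hA hRA h0 hbdd, relKer_subset_Mseq_of_relAdj hdomB hRA⟩
  exact ⟨fun n _ => key n, by simp only [nuRel, key]⟩
end

section
/- Let X and Y be complex Banach spaces. Let A be a closed linear relation from X to Y with closed range R(A), let γ > 0 be a lower bound for A, and let B be a closed linear relation from X to Y with D(A) ⊆ D(B), B(0) ⊆ A(0), which is relatively bounded with respect to A with constants σ, τ ≥ 0. Then: (i) for every λ ∈ ℂ with |λ|·(σ + τγ) < γ, the relation A − λB is closed; (ii) if there exists y ∈ R(A) with y ∉ A(0), and if λ ∈ ℂ is such that D(A) ⊆ N(A − λB) (equivalently (A − λB)(x) = (A − λB)(0) for every x ∈ D(A), i.e. γ(A − λB) = ∞), then |λ|·(σ + τγ) ≥ γ. -/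
open Metric Set

section Defs

variable {X Y : Type*} [AddCommGroup X] [Module ℂ X] [AddCommGroup Y] [Module ℂ Y]

/-- The linear relation `A - λB`, with graph
`{(x, y - λ • z) : (x, y) ∈ G(A), (x, z) ∈ G(B)}`. -/
def subRel (lam : ℂ) (A B : Submodule ℂ (X × Y)) : Submodule ℂ (X × Y) where
  carrier := {p | ∃ y z, (p.1, y) ∈ A ∧ (p.1, z) ∈ B ∧ p.2 = y - lam • z}
  add_mem' := by
    rintro ⟨x₁, w₁⟩ ⟨x₂, w₂⟩ ⟨y₁, z₁, hA₁, hB₁, rfl⟩ ⟨y₂, z₂, hA₂, hB₂, rfl⟩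
    refine ⟨y₁ + y₂, z₁ + z₂, A.add_mem hA₁ hA₂, B.add_mem hB₁ hB₂, ?_⟩
    show (y₁ - lam • z₁) + (y₂ - lam • z₂) = (y₁ + y₂) - lam • (z₁ + z₂)
    rw [smul_add]; abel
  zero_mem' := ⟨0, 0, A.zero_mem, B.zero_mem, by simp⟩
  smul_mem' := by
    rintro c ⟨x, w⟩ ⟨y, z, hA, hB, rfl⟩
    refine ⟨c • y, c • z, A.smul_mem c hA, B.smul_mem c hB, ?_⟩
    show c • (y - lam • z) = c • y - lam • (c • z)
    rw [smul_sub, smul_comm]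

end Defs

/-- The set `A(0)` of a linear relation, as a submodule. -/
def mulSubmodule {X Y : Type*} [AddCommGroup X] [Module ℂ X] [AddCommGroup Y] [Module ℂ Y]
    (A : Submodule ℂ (X × Y)) : Submodule ℂ Y :=
  A.comap (LinearMap.inr ℂ X Y)

section Relation

variable {X Y : Type*} [NormedAddCommGroup X] [NormedSpace ℂ X]
  [NormedAddCommGroup Y] [NormedSpace ℂ Y]

theorem coe_mulSubmodule (A : Submodule ℂ (X × Y)) :
    (mulSubmodule A : Set Y) = relMul0 A := rfl

theorem isClosed_mulSubmodule {A : Submodule ℂ (X × Y)} (hA : IsClosed (A : Set (X × Y))) :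
    IsClosed (mulSubmodule A : Set Y) :=
  hA.preimage (f := fun y : Y => ((0 : X), y)) (by fun_prop)

theorem norm_mkQ_eq_infDist (S : Submodule ℂ Y) (y : Y) :
    ‖S.mkQ y‖ = infDist y (S : Set Y) :=
  QuotientAddGroup.norm_mk (S := S.toAddSubgroup) y

theorem norm_mkQ_mul_eq_infDist_closure (A : Submodule ℂ (X × Y)) (y : Y) :
    ‖(mulSubmodule A).mkQ y‖ = infDist y (closure (relMul0 A)) := by
  rw [infDist_closure, norm_mkQ_eq_infDist, coe_mulSubmodule]

theorem norm_mkQ_le_of_le {S T : Submodule ℂ Y} (h : S ≤ T) (y : Y) :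
    ‖T.mkQ y‖ ≤ ‖S.mkQ y‖ := by
  rw [norm_mkQ_eq_infDist, norm_mkQ_eq_infDist]
  exact infDist_le_infDist_of_subset h ⟨0, S.zero_mem⟩

theorem mem_of_mkQ_mul_eq {A : Submodule ℂ (X × Y)} {x : X} {y y' : Y} (h : (x, y) ∈ A)
    (hy : (mulSubmodule A).mkQ y = (mulSubmodule A).mkQ y') : (x, y') ∈ A := by
  have hd : ((0 : X), y - y') ∈ A := (Submodule.Quotient.eq _).1 hy
  simpa using A.sub_mem h hd

/-- Relations with closed graph are closed under limits taken modulo `A(0)`. -/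
theorem mem_of_tendsto_mkQ_mul {A : Submodule ℂ (X × Y)} (hA : IsClosed (A : Set (X × Y)))
    {x : ℕ → X} {y : ℕ → Y} {a : X} {b : Y} (h : ∀ n, (x n, y n) ∈ A)
    (hx : Filter.Tendsto x Filter.atTop (nhds a))
    (hy : Filter.Tendsto (fun n => (mulSubmodule A).mkQ (y n)) Filter.atTop
      (nhds ((mulSubmodule A).mkQ b))) : (a, b) ∈ A := by
  set f : X × Y → X × (Y ⧸ mulSubmodule A) := Prod.map id (mulSubmodule A).mkQ with hf
  have hq : IsOpenQuotientMap f :=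
    IsOpenQuotientMap.id.prodMap (Submodule.isOpenQuotientMap_mkQ _)
  have hpre : f ⁻¹' (f '' (A : Set (X × Y))) = A := by
    refine Subset.antisymm ?_ (subset_preimage_image _ _)
    rintro ⟨u, v⟩ ⟨⟨u', v'⟩, hm, he⟩
    obtain ⟨rfl, hv⟩ : u' = u ∧ (mulSubmodule A).mkQ v' = (mulSubmodule A).mkQ v := by
      simpa [hf] using he
    exact mem_of_mkQ_mul_eq hm hv
  have hcl : IsClosed (f '' (A : Set (X × Y))) := by
    rw [← hq.isQuotientMap.isClosed_preimage, hpre]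
    exact hA
  have hmem : f (a, b) ∈ f '' (A : Set (X × Y)) :=
    hcl.mem_of_tendsto (hx.prodMk_nhds hy)
      (Filter.Eventually.of_forall fun n => mem_image_of_mem f (h n))
  have : (a, b) ∈ f ⁻¹' (f '' (A : Set (X × Y))) := hmem
  rwa [hpre] at this

theorem cauchySeq_of_norm_sub_le {E F : Type*} [SeminormedAddCommGroup E]
    [SeminormedAddCommGroup F] {u : ℕ → E} {v : ℕ → F} (hu : CauchySeq u) {C : ℝ} (hC : 0 ≤ C)
    (h : ∀ m n, ‖v m - v n‖ ≤ C * ‖u m - u n‖) : CauchySeq v := by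
  rw [Metric.cauchySeq_iff] at hu ⊢
  intro ε hε
  obtain ⟨N, hN⟩ := hu (ε / (C + 1)) (by positivity)
  refine ⟨N, fun m hm n hn => ?_⟩
  have h1 := hN m hm n hn
  rw [dist_eq_norm, lt_div_iff₀ (by positivity)] at h1
  rw [dist_eq_norm]
  nlinarith [h m n, norm_nonneg (u m - u n)]

/-- If `B` is `A`-bounded and `|λ|` times the relative bound is less than one, then
`A - λB` is closed. -/
theorem isClosed_subRel [CompleteSpace Y] {A B : Submodule ℂ (X × Y)}
    (hA : IsClosed (A : Set (X × Y))) (hB : IsClosed (B : Set (X × Y)))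
    (h0 : mulSubmodule B ≤ mulSubmodule A) {σ τ : ℝ} (hσ : 0 ≤ σ) (hτ : 0 ≤ τ)
    (hrb : ∀ x y, (x, y) ∈ A → ∀ z, (x, z) ∈ B →
      ‖(mulSubmodule B).mkQ z‖ ≤ σ * ‖x‖ + τ * ‖(mulSubmodule A).mkQ y‖)
    {lam : ℂ} (hlam : ‖lam‖ * τ < 1) :
    IsClosed ((subRel lam A B : Submodule ℂ (X × Y)) : Set (X × Y)) := by
  have := isClosed_mulSubmodule hA
  set p := (mulSubmodule A).mkQ
  set q := (mulSubmodule B).mkQ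
  refine IsSeqClosed.isClosed fun s l hs hl => ?_
  obtain ⟨x, w⟩ := l
  choose y z hy hz hw using hs
  have hx := (continuous_fst.tendsto _).comp hl
  have hw' := (continuous_snd.tendsto _).comp hl
  have hpq : ∀ v, ‖p v‖ ≤ ‖q v‖ := norm_mkQ_le_of_le h0
  have hB' : ∀ m n, ‖q (z m) - q (z n)‖ ≤
      σ * ‖s m - s n‖ + τ * ‖p (y m) - p (y n)‖ := by
    intro m n
    have h1 := hrb ((s m).1 - (s n).1) (y m - y n) (A.sub_mem (hy m) (hy n))
      (z m - z n) (B.sub_mem (hz m) (hz n))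
    have h2 : ‖(s m).1 - (s n).1‖ ≤ ‖s m - s n‖ := norm_fst_le (s m - s n)
    rw [map_sub, map_sub] at h1
    exact h1.trans (by gcongr)
  have hA' : ∀ m n, ‖p (y m) - p (y n)‖ ≤
      ((1 + ‖lam‖ * σ) / (1 - ‖lam‖ * τ)) * ‖s m - s n‖ := by
    intro m n
    have e : p (y m) - p (y n) = p ((s m).2 - (s n).2) + lam • p (z m - z n) := by
      rw [hw m, hw n]
      simp only [map_sub, map_smul, smul_sub]
      abel
    have h1 : ‖p ((s m).2 - (s n).2)‖ ≤ ‖s m - s n‖ :=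
      (Submodule.Quotient.norm_mk_le _ _).trans (norm_snd_le (s m - s n))
    have h2 : ‖lam • p (z m - z n)‖ ≤
        ‖lam‖ * (σ * ‖s m - s n‖ + τ * ‖p (y m) - p (y n)‖) := by
      rw [norm_smul]
      gcongr
      refine (hpq _).trans ?_
      rw [map_sub]
      exact hB' m n
    have h3 : ‖p (y m) - p (y n)‖ ≤ ‖p ((s m).2 - (s n).2)‖ + ‖lam • p (z m - z n)‖ := by
      rw [e]
      exact norm_add_le _ _
    rw [div_mul_eq_mul_div, le_div_iff₀ (by linarith)]
    nlinarith
  have hK : 0 ≤ (1 + ‖lam‖ * σ) / (1 - ‖lam‖ * τ) :=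
    div_nonneg (by positivity) (by linarith)
  obtain ⟨η, hη⟩ := cauchySeq_tendsto_of_complete
    (cauchySeq_of_norm_sub_le (v := fun n => p (y n)) hl.cauchySeq hK hA')
  obtain ⟨y', rfl⟩ := (mulSubmodule A).mkQ_surjective η
  have hcq : CauchySeq fun n => q (z n) := by
    refine cauchySeq_of_norm_sub_le hl.cauchySeq
      (C := σ + τ * ((1 + ‖lam‖ * σ) / (1 - ‖lam‖ * τ))) (by positivity) fun m n => ?_
    calc _ ≤ _ := hB' m n
      _ ≤ σ * ‖s m - s n‖ + τ * (((1 + ‖lam‖ * σ) / (1 - ‖lam‖ * τ)) * ‖s m - s n‖) := by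
        gcongr
        exact hA' m n
      _ = _ := by ring
  obtain ⟨ζ, hζ⟩ := cauchySeq_tendsto_of_complete hcq
  obtain ⟨z', rfl⟩ := (mulSubmodule B).mkQ_surjective ζ
  have hyA : (x, y') ∈ A := mem_of_tendsto_mkQ_mul hA hy hx hη
  have hzB : (x, z') ∈ B := mem_of_tendsto_mkQ_mul hB hz hx hζ
  have hpz : Filter.Tendsto (fun n => p (z n)) Filter.atTop (nhds (p z')) := by
    rw [tendsto_iff_norm_sub_tendsto_zero] at hζ ⊢
    refine squeeze_zero (fun _ => norm_nonneg _) (fun n => ?_) hζ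
    rw [← map_sub, ← map_sub]
    exact hpq _
  have hpw : Filter.Tendsto (fun n => p (s n).2) Filter.atTop (nhds (p w)) :=
    ((Submodule.isOpenQuotientMap_mkQ (mulSubmodule A)).continuous.tendsto w).comp hw'
  have hlim : p w = p (y' - lam • z') := by
    refine tendsto_nhds_unique hpw ?_
    rw [map_sub, map_smul]
    refine (hη.sub (hpz.const_smul lam)).congr fun n => ?_
    rw [hw n, map_sub, map_smul]
  refine ⟨w + lam • z', z', mem_of_mkQ_mul_eq hyA ?_, hzB, by simp⟩
  change p y' = p (w + lam • z')
  rw [map_add, hlim, ← map_add, sub_add_cancel]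

/-- If `A - λB` vanishes on `D(A)` and `A` takes a value outside `A(0)`, then `|λ|` cannot
be small. -/
theorem le_of_relDom_subset_relKer_subRel {A B : Submodule ℂ (X × Y)}
    (hA : IsClosed (A : Set (X × Y))) {γ : ℝ} (hγ : 0 ≤ γ)
    (hlb : ∀ x y, (x, y) ∈ A → γ * infDist x (relKer A) ≤ ‖(mulSubmodule A).mkQ y‖)
    (h0 : mulSubmodule B ≤ mulSubmodule A) {σ τ : ℝ} (hσ : 0 ≤ σ)
    (hrb : ∀ x y, (x, y) ∈ A → ∀ z, (x, z) ∈ B →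
      ‖(mulSubmodule B).mkQ z‖ ≤ σ * ‖x‖ + τ * ‖(mulSubmodule A).mkQ y‖)
    (hne : ∃ y ∈ relRan A, y ∉ relMul0 A)
    {lam : ℂ} (hker : relDom A ⊆ relKer (subRel lam A B)) : γ ≤ ‖lam‖ * (σ + τ * γ) := by
  have := isClosed_mulSubmodule hA
  obtain ⟨y, ⟨x, hxy⟩, hy⟩ := hne
  set p := (mulSubmodule A).mkQ
  set d := ‖p y‖ with hd
  have hd0 : 0 < d := by
    refine norm_pos_iff.2 fun h => hy ?_
    exact (Submodule.Quotient.mk_eq_zero (mulSubmodule A)).1 h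
  have hbound : ∀ x', (x', y) ∈ A → d ≤ ‖lam‖ * (σ * ‖x'‖ + τ * d) := by
    intro x' hx'
    obtain ⟨v, z, hv, hz, hvz⟩ := hker ⟨y, hx'⟩
    obtain rfl : v = lam • z := (sub_eq_zero.1 hvz.symm)
    have hp : p y = lam • p z := by
      rw [← map_smul]
      refine (Submodule.Quotient.eq (mulSubmodule A)).2 ?_
      change ((0 : X), y - lam • z) ∈ A
      simpa using A.sub_mem hx' hv
    calc d = ‖lam‖ * ‖p z‖ := by rw [hd, hp, norm_smul]
      _ ≤ _ := by
        gcongr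
        exact (norm_mkQ_le_of_le h0 z).trans (hrb _ _ hx' _ hz)
  have hdist : d ≤ ‖lam‖ * (σ * infDist x (relKer A) + τ * d) := by
    have hcont : Continuous fun t : ℝ => ‖lam‖ * (σ * t + τ * d) := by fun_prop
    refine ge_of_tendsto (x := nhdsWithin (infDist x (relKer A)) (Ioi (infDist x (relKer A))))
      hcont.continuousWithinAt.tendsto ?_
    filter_upwards [self_mem_nhdsWithin] with t ht
    obtain ⟨u, hu, hut⟩ := (infDist_lt_iff (s := relKer A) ⟨0, A.zero_mem⟩).1 ht
    have hxu : (x - u, y) ∈ A := by simpa using A.sub_mem hxy hu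
    refine (hbound _ hxu).trans ?_
    rw [dist_eq_norm] at hut
    gcongr
  have h1 := hlb x y hxy
  have h2 : γ * d ≤ ‖lam‖ * (σ + τ * γ) * d :=
    calc γ * d ≤ γ * (‖lam‖ * (σ * infDist x (relKer A) + τ * d)) := by gcongr
      _ = ‖lam‖ * (σ * (γ * infDist x (relKer A)) + τ * γ * d) := by ring
      _ ≤ ‖lam‖ * (σ * d + τ * γ * d) := by gcongr
      _ = _ := by ring
  exact le_of_mul_le_mul_right h2 hd0

end Relation


theorem stmt16 {X Y : Type*} [NormedAddCommGroup X] [NormedSpace ℂ X] [CompleteSpace X]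
    [NormedAddCommGroup Y] [NormedSpace ℂ Y] [CompleteSpace Y]
    (A B : Submodule ℂ (X × Y))
    (hA : IsClosed (A : Set (X × Y))) (hB : IsClosed (B : Set (X × Y)))
    (hRA : IsClosed (relRan A))
    (γ : ℝ) (hγ : 0 < γ)
    (hlb : ∀ x y, (x, y) ∈ A → γ * infDist x (relKer A) ≤ infDist y (closure (relMul0 A)))
    (hdom : relDom A ⊆ relDom B) (h0 : relMul0 B ⊆ relMul0 A)
    (σ τ : ℝ) (hσ : 0 ≤ σ) (hτ : 0 ≤ τ)
    (hrb : ∀ x y, (x, y) ∈ A → ∀ z, (x, z) ∈ B →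
      infDist z (closure (relMul0 B)) ≤ σ * ‖x‖ + τ * infDist y (closure (relMul0 A))) :
    (∀ lam : ℂ, ‖lam‖ * (σ + τ * γ) < γ →
      IsClosed ((subRel lam A B : Submodule ℂ (X × Y)) : Set (X × Y))) ∧
    ((∃ y ∈ relRan A, y ∉ relMul0 A) →
      ∀ lam : ℂ, relDom A ⊆ relKer (subRel lam A B) → γ ≤ ‖lam‖ * (σ + τ * γ)) := by
  simp only [← norm_mkQ_mul_eq_infDist_closure] at hlb hrb
  refine ⟨fun lam hlam => isClosed_subRel hA hB h0 hσ hτ hrb ?_, fun hne lam hker =>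
    le_of_relDom_subset_relKer_subRel hA hγ.le hlb h0 hσ hrb hne hker⟩
  have := mul_nonneg (norm_nonneg lam) hσ
  exact lt_of_mul_lt_mul_right (by linarith) hγ.le
end
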